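/- (Lower bound for number of Lasso selections under signal condition.) In the Gaussian linear model Y = Xθ + ε with ε ~ N(0, σ²I), under block-orthogonality with unit-norm columns, suppose at least Kξ blocks contain a variable j with |X_jᵀ μ| ≥ λ, where μ = Xθ and ξ ∈ (0,1]. Then the number of selected variables R = |{j : θ̂_j(λ) ≠ 0}| is stochastically larger than a Binomial(⌈Kξ⌉, 1/2) random variable, and for any q < ξ/2, P(R ≤ Kq) ≤ exp(−K(ξ−2q)²/(4ξ)). -/

import Mathlib

open MeasureTheory ProbabilityTheory
open scoped BigOperators ENNReal Classical

/-- The Lasso objective `(1/2)‖y − Xθ‖² + λ‖θ‖₁`. -/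
noncomputable def lassoObj {n d : ℕ} (X : Matrix (Fin n) (Fin d) ℝ) (y : Fin n → ℝ)
    (lam : ℝ) (θ : Fin d → ℝ) : ℝ :=
  (1 / 2) * ∑ i, (y i - X.mulVec θ i) ^ 2 + lam * ∑ j, |θ j|

lemma lassoObj_add_single {n d : ℕ} (X : Matrix (Fin n) (Fin d) ℝ) (y : Fin n → ℝ) (lam : ℝ)
    (θ : Fin d → ℝ) (j : Fin d) (hnorm : ∑ i, (X i j) ^ 2 = 1) (hj : θ j = 0) (s : ℝ) :
    lassoObj X y lam (θ + Pi.single j s) =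
      lassoObj X y lam θ - s * ∑ i, X i j * (y i - X.mulVec θ i) + s ^ 2 / 2 + lam * |s| := by
  have hquad : ∑ i, (y i - X.mulVec (θ + Pi.single j s) i) ^ 2 =
      ∑ i, (y i - X.mulVec θ i) ^ 2 - 2 * s * ∑ i, X i j * (y i - X.mulVec θ i) + s ^ 2 := by
    have : s ^ 2 = s ^ 2 * ∑ i, (X i j) ^ 2 := by rw [hnorm, mul_one]
    rw [this, Finset.mul_sum, Finset.mul_sum, ← Finset.sum_sub_distrib, ← Finset.sum_add_distrib]
    refine Finset.sum_congr rfl fun i _ => ?_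
    simp only [Matrix.mulVec_add, Matrix.mulVec_single, Pi.add_apply, Pi.smul_apply,
      Matrix.col_apply, MulOpposite.smul_eq_mul_unop, MulOpposite.unop_op]
    ring
  have habs : ∑ l, |(θ + Pi.single j s : Fin d → ℝ) l| = ∑ l, |θ l| + |s| := by
    have : |s| = ∑ l, if l = j then |s| else 0 := by simp
    rw [this, ← Finset.sum_add_distrib]
    refine Finset.sum_congr rfl fun l _ => ?_
    by_cases h : l = j
    · subst h; simp [hj]
    · simp [h]
  rw [lassoObj, lassoObj, hquad, habs]
  ring

/-- The stationarity condition of the Lasso at an inactive unit-norm column. -/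
lemma abs_residual_corr_le {n d : ℕ} (X : Matrix (Fin n) (Fin d) ℝ) (y : Fin n → ℝ) (lam : ℝ)
    (θ : Fin d → ℝ) (hθ : ∀ η, lassoObj X y lam θ ≤ lassoObj X y lam η)
    (j : Fin d) (hnorm : ∑ i, (X i j) ^ 2 = 1) (hj : θ j = 0) :
    |∑ i, X i j * (y i - X.mulVec θ i)| ≤ lam := by
  set g := ∑ i, X i j * (y i - X.mulVec θ i) with hg
  have key (s : ℝ) : 0 ≤ - s * g + s ^ 2 / 2 + lam * |s| := by
    have := hθ (θ + Pi.single j s)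
    rw [lassoObj_add_single X y lam θ j hnorm hj s] at this
    linarith
  rw [abs_le]
  constructor
  · by_contra! h
    have := key (g + lam)
    rw [abs_of_neg (by linarith)] at this
    nlinarith
  · by_contra! h
    have := key (g - lam)
    rw [abs_of_pos (by linarith)] at this
    nlinarith

/-- If the Lasso selects nothing in a block orthogonal to the others, every column of that block
has correlation at most `lam` with the response. -/
lemma abs_corr_le_of_block_eq_zero {n d : ℕ} {κ : Type*} (X : Matrix (Fin n) (Fin d) ℝ)
    (B : Fin d → κ) (horth : ∀ j l : Fin d, B j ≠ B l → ∑ i, X i j * X i l = 0)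
    (y : Fin n → ℝ) (lam : ℝ) (θ : Fin d → ℝ)
    (hθ : ∀ η, lassoObj X y lam θ ≤ lassoObj X y lam η)
    (j : Fin d) (hnorm : ∑ i, (X i j) ^ 2 = 1) (hj : ∀ l, B l = B j → θ l = 0) :
    |∑ i, X i j * y i| ≤ lam := by
  have h0 : ∑ i, X i j * X.mulVec θ i = 0 := by
    simp only [Matrix.mulVec, dotProduct, Finset.mul_sum]
    rw [Finset.sum_comm]
    refine Finset.sum_eq_zero fun l _ => ?_
    by_cases h : B l = B j
    · simp [hj l h]
    · simp_rw [← mul_assoc]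
      rw [← Finset.sum_mul, horth j l (Ne.symm h), zero_mul]
  have := abs_residual_corr_le X y lam θ hθ j hnorm (hj j rfl)
  simpa only [mul_sub, Finset.sum_sub_distrib, h0, sub_zero] using this

lemma gaussianReal_Ioi_mean (m : ℝ) {v : NNReal} (hv : v ≠ 0) :
    gaussianReal m v (Set.Ioi m) = 1 / 2 := by
  have := nullSingletonClass_gaussianReal (μ := m) hv
  have hsymm : gaussianReal m v (Set.Iio m) = gaussianReal m v (Set.Ioi m) := by
    have h := gaussianReal_map_const_sub (μ := m) (v := v) (2 * m)
    rw [show 2 * m - m = m by ring] at h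
    conv_lhs => rw [← h, Measure.map_apply (by fun_prop) measurableSet_Iio]
    congr 1
    ext x
    simp only [Set.mem_preimage, Set.mem_Iio, Set.mem_Ioi]
    constructor <;> intro <;> linarith
  have htot := measure_add_measure_compl (μ := gaussianReal m v) (measurableSet_Ioi (a := m))
  rw [Set.compl_Ioi, ← measure_congr Iio_ae_eq_Iic, hsymm, measure_univ, ← two_mul] at htot
  rw [ENNReal.eq_div_iff (by simp) (by simp), htot]

/-- The probability that a `Binomial(m, 1/2)` variable is at most `t`. -/
noncomputable def fairBinomialCDF (m : ℕ) (t : ℝ) : ℝ :=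
  ∑ k ∈ Finset.range (m + 1), (m.choose k : ℝ) * (if (k : ℝ) ≤ t then (1 / 2) ^ m else 0)

lemma binomial_half_toMeasure_le (m : ℕ) (h : (1 / 2 : NNReal) ≤ 1) (t : ℝ) :
    (PMF.binomial (1 / 2) h m).toMeasure {x | ((x : ℕ) : ℝ) ≤ t} =
      ENNReal.ofReal (fairBinomialCDF m t) := by
  rw [PMF.toMeasure_apply_fintype, fairBinomialCDF, ← Fin.sum_univ_eq_sum_range
    (fun k => (m.choose k : ℝ) * (if (k : ℝ) ≤ t then (1 / 2) ^ m else 0)),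
    ENNReal.ofReal_sum_of_nonneg (fun i _ => by positivity)]
  refine Finset.sum_congr rfl fun k _ => ?_
  by_cases hk : ((k : ℕ) : ℝ) ≤ t
  · have hhalf : (1 : ℝ≥0∞) - ((1 / 2 : NNReal) : ℝ≥0∞) = ((1 / 2 : NNReal) : ℝ≥0∞) := by
      rw [← ENNReal.coe_one, ← ENNReal.coe_sub]
      congr 1
      rw [tsub_eq_iff_eq_add_of_le h, add_halves]
    rw [Set.indicator_of_mem (by exact hk), PMF.binomial_apply, hhalf, ← pow_add, if_pos hk,
      mul_comm, ENNReal.ofReal_mul (by positivity), ENNReal.ofReal_natCast,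
      ENNReal.ofReal_pow (by positivity)]
    congr 2
    · rw [← ENNReal.ofReal_coe_nnreal]; norm_num
    · simpa using Nat.add_sub_cancel' (Nat.lt_succ_iff.mp k.isLt)
  · rw [Set.indicator_of_notMem (by exact hk), if_neg hk, mul_zero, ENNReal.ofReal_zero]

/-- Hoeffding's lower tail bound for the fair binomial distribution. -/
lemma fairBinomialCDF_le_exp {m : ℕ} (hm : 0 < m) {a : ℝ} (ha : a ≤ m / 2) :
    fairBinomialCDF m a ≤ Real.exp (-(m - 2 * a) ^ 2 / (2 * m)) := by
  have hm' : (0 : ℝ) < m := by exact_mod_cast hm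
  set u : ℝ := 4 * (m / 2 - a) / m with hu
  have hu0 : 0 ≤ u := by
    have : 0 ≤ (m : ℝ) / 2 - a := by linarith
    positivity
  calc fairBinomialCDF m a
      ≤ ∑ k ∈ Finset.range (m + 1),
          (m.choose k : ℝ) * (Real.exp (u * (a - k)) * (1 / 2) ^ m) := by
        refine Finset.sum_le_sum fun k _ => mul_le_mul_of_nonneg_left ?_ (by positivity)
        split_ifs with h
        · exact le_mul_of_one_le_left (by positivity)
            (Real.one_le_exp (mul_nonneg hu0 (by linarith)))
        · positivity
    _ = Real.exp (u * a) * ((Real.exp (-u) + 1) / 2) ^ m := by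
        rw [div_pow (Real.exp (-u) + 1), add_pow, Finset.sum_div, Finset.mul_sum]
        refine Finset.sum_congr rfl fun k _ => ?_
        rw [mul_sub, sub_eq_add_neg, Real.exp_add, ← Real.exp_nat_mul,
          show (k : ℝ) * -u = -(u * k) by ring]
        simp only [one_pow, mul_one, one_div, inv_pow]
        ring
    _ = Real.exp (u * a - m * u / 2) * Real.cosh (u / 2) ^ m := by
        have : (Real.exp (-u) + 1) / 2 = Real.exp (-(u / 2)) * Real.cosh (u / 2) := by
          rw [Real.cosh_eq, mul_div_assoc', mul_add, ← Real.exp_add, ← Real.exp_add]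
          ring_nf
          simp [add_comm]
        rw [this, mul_pow, ← Real.exp_nat_mul, ← mul_assoc, ← Real.exp_add]
        ring_nf
    _ ≤ Real.exp (u * a - m * u / 2) * Real.exp ((u / 2) ^ 2 / 2) ^ m := by
        gcongr
        exact Real.cosh_le_exp_half_sq _
    _ = Real.exp (-(m - 2 * a) ^ 2 / (2 * m)) := by
        rw [← Real.exp_nat_mul, ← Real.exp_add, hu]
        congr 1
        field_simp
        ring

/-- The number of independent events of probability `1/2` that occur is `Binomial(m, 1/2)`. -/
lemma measure_card_mem_le {Ω : Type*} [MeasurableSpace Ω] {P : Measure Ω} {m : ℕ}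
    {V : Fin m → Ω → ℝ} (hV : iIndepFun V P) {s : Fin m → Set ℝ}
    (hs : ∀ i, MeasurableSet (s i)) (hP : ∀ i, P (V i ⁻¹' s i) = 1 / 2)
    (hP' : ∀ i, P (V i ⁻¹' (s i)ᶜ) = 1 / 2) (t : ℝ) :
    P {ω | ((Finset.univ.filter fun i => V i ω ∈ s i).card : ℝ) ≤ t} ≤
      ENNReal.ofReal (fairBinomialCDF m t) := by
  have hpat (T : Finset (Fin m)) :
      P {ω | (Finset.univ.filter fun i => V i ω ∈ s i) = T} = ENNReal.ofReal ((1 / 2) ^ m) := by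
    have h := hV.measure_inter_preimage_eq_mul Finset.univ
      (sets := fun i => if i ∈ T then s i else (s i)ᶜ)
      (fun i _ => by split_ifs; exacts [hs i, (hs i).compl])
    have h1 : ∀ i, P (V i ⁻¹' (if i ∈ T then s i else (s i)ᶜ)) = 1 / 2 := by
      intro i; split_ifs; exacts [hP i, hP' i]
    simp only [h1, Finset.prod_const, Finset.card_univ, Fintype.card_fin] at h
    rw [ENNReal.ofReal_pow (by positivity), ENNReal.ofReal_div_of_pos (by norm_num)]
    simp only [ENNReal.ofReal_one, ENNReal.ofReal_ofNat]
    rw [← h]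
    congr 1
    ext ω
    simp only [Set.mem_ofPred_eq, Finset.ext_iff, Finset.mem_filter, Finset.mem_univ, true_and,
      Set.mem_iInter, forall_true_left, Set.mem_preimage]
    refine forall_congr' fun i => ?_
    split_ifs with hi <;> simp [hi]
  calc _ ≤ P (⋃ T ∈ (Finset.univ.filter fun T : Finset (Fin m) => (T.card : ℝ) ≤ t),
          {ω | (Finset.univ.filter fun i => V i ω ∈ s i) = T}) :=
        measure_mono fun ω hω => by simpa using hω
    _ ≤ ∑ T ∈ (Finset.univ.filter fun T : Finset (Fin m) => (T.card : ℝ) ≤ t),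
          P {ω | (Finset.univ.filter fun i => V i ω ∈ s i) = T} :=
        measure_biUnion_finset_le _ _
    _ = ENNReal.ofReal (fairBinomialCDF m t) := by
        simp_rw [hpat]
        rw [← ENNReal.ofReal_sum_of_nonneg (fun i _ => by positivity), Finset.sum_filter,
          ← Finset.powerset_univ, Finset.sum_powerset_apply_card
            (fun k => if (k : ℝ) ≤ t then ((1 : ℝ) / 2) ^ m else 0)]
        simp [fairBinomialCDF]

/-- Orthonormal linear forms of a homoscedastic Gaussian vector are independent Gaussians. -/
lemma iIndepFun_and_map_orthonormal_forms {Ω : Type*} [MeasurableSpace Ω] {P : Measure Ω}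
    [IsProbabilityMeasure P] {n m : ℕ} {Y : Ω → Fin n → ℝ} (hY : Measurable Y)
    {μ : Fin n → ℝ} {v : NNReal}
    (hlaw : Measure.map Y P = Measure.pi fun i => gaussianReal (μ i) v)
    {a : Fin m → Fin n → ℝ} (hnorm : ∀ k, ∑ i, a k i ^ 2 = 1)
    (horth : ∀ k l, k ≠ l → ∑ i, a k i * a l i = 0) :
    iIndepFun (fun k ω => ∑ i, a k i * Y ω i) P ∧
      ∀ k, Measure.map (fun ω => ∑ i, a k i * Y ω i) P = gaussianReal (∑ i, a k i * μ i) v := by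
  have hYi (i : Fin n) : Measurable fun ω => Y ω i := by fun_prop
  have hmap (i : Fin n) : Measure.map (fun ω => Y ω i) P = gaussianReal (μ i) v := by
    have : (fun ω => Y ω i) = (fun y : Fin n → ℝ => y i) ∘ Y := rfl
    rw [this, ← Measure.map_map (by fun_prop) hY, hlaw]
    exact (measurePreserving_eval _ i).map_eq
  have hind : iIndepFun (fun i ω => Y ω i) P := by
    rw [iIndepFun_iff_map_fun_eq_pi_map fun i => (hYi i).aemeasurable]
    simp_rw [hmap]
    exact hlaw
  have hgi (i : Fin n) : HasGaussianLaw (fun ω => Y ω i) P := ⟨by rw [hmap]; infer_instance⟩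
  have hg : HasGaussianLaw Y P := hind.hasGaussianLaw hgi
  let L : (Fin n → ℝ) →L[ℝ] (Fin m → ℝ) := (Matrix.mulVecLin (Matrix.of a)).toContinuousLinearMap
  have hW : HasGaussianLaw (fun ω => fun k => ∑ i, a k i * Y ω i) P := hg.map_fun L
  have hmean (i : Fin n) : ∫ ω, Y ω i ∂P = μ i := by
    have := integral_map (μ := P) (φ := fun ω => Y ω i) (hYi i).aemeasurable
      (f := id) (by fun_prop)
    rw [hmap] at this
    simpa using this.symm
  have hcov (i l : Fin n) : cov[fun ω => Y ω i, fun ω => Y ω l; P] =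
      if i = l then (v : ℝ) else 0 := by
    split_ifs with h
    · subst h
      rw [covariance_self (hYi i).aemeasurable]
      have := variance_id_map (μ := P) (X := fun ω => Y ω i) (hYi i).aemeasurable
      rw [← this, hmap, variance_id_gaussianReal]
    · exact (hind.indepFun h).covariance_eq_zero (hgi i).memLp_two (hgi l).memLp_two
  have hcovW (k l : Fin m) : cov[fun ω => ∑ i, a k i * Y ω i, fun ω => ∑ i, a l i * Y ω i; P] =
      v * ∑ i, a k i * a l i := by
    rw [covariance_fun_sum_fun_sum (fun i => (hgi i).memLp_two.const_mul _)
      (fun i => (hgi i).memLp_two.const_mul _)]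
    simp only [covariance_const_mul_left, covariance_const_mul_right, hcov, mul_ite, mul_zero,
      Finset.sum_ite_eq, Finset.mem_univ, if_true, Finset.mul_sum]
    refine Finset.sum_congr rfl fun i _ => by ring
  refine ⟨hW.iIndepFun_of_covariance_eq_zero fun k l hkl => ?_, fun k => ?_⟩
  · rw [hcovW, horth k l hkl, mul_zero]
  · rw [(hW.eval k).map_eq_gaussianReal]
    congr 1
    · rw [integral_finsetSum _ fun i _ => (hgi i).integrable.const_mul _]
      simp [integral_const_mul, hmean]
    · rw [← covariance_self (hW.eval k).aemeasurable, hcovW]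
      simp [← pow_two, hnorm]

/-- The number of Lasso selections stochastically dominates a `Binomial(m, 1/2)` variable when `m`
distinct blocks carry a variable with signal at least `lam`. -/
lemma measure_card_selected_le {Ω : Type*} [MeasurableSpace Ω] (P : Measure Ω)
    [IsProbabilityMeasure P] {n d m : ℕ} {κ : Type*}
    (X : Matrix (Fin n) (Fin d) ℝ) (B : Fin d → κ)
    (horth : ∀ j l : Fin d, B j ≠ B l → ∑ i, X i j * X i l = 0)
    (hnorm : ∀ j : Fin d, ∑ i, (X i j) ^ 2 = 1)
    (μ : Fin n → ℝ) {v : NNReal} (hv : v ≠ 0)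
    (Y : Ω → Fin n → ℝ) (hY : Measurable Y)
    (hlaw : Measure.map Y P = Measure.pi fun i => gaussianReal (μ i) v)
    (lam : ℝ) (f : Fin m → Fin d) (hf : Function.Injective (B ∘ f))
    (hsignal : ∀ k, lam ≤ |∑ i, X i (f k) * μ i|)
    (θhat : Ω → Fin d → ℝ)
    (hθhat : ∀ ω, ∀ η : Fin d → ℝ, lassoObj X (Y ω) lam (θhat ω) ≤ lassoObj X (Y ω) lam η)
    (t : ℝ) :
    P {ω | ((Finset.univ.filter (fun j : Fin d => θhat ω j ≠ 0)).card : ℝ) ≤ t} ≤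
      ENNReal.ofReal (fairBinomialCDF m t) := by
  obtain ⟨s, hs, hsabs⟩ : ∃ s : Fin m → ℝ, (∀ k, |s k| = 1) ∧
      ∀ k, s k * ∑ i, X i (f k) * μ i = |∑ i, X i (f k) * μ i| := by
    have (x : ℝ) : ∃ s : ℝ, |s| = 1 ∧ s * x = |x| := by
      rcases le_total 0 x with h | h
      · exact ⟨1, by simp, by rw [abs_of_nonneg h, one_mul]⟩
      · exact ⟨-1, by simp, by rw [abs_of_nonpos h]; ring⟩
    choose s hs using this
    exact ⟨fun k => s _, fun k => (hs _).1, fun k => (hs _).2⟩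
  let a : Fin m → Fin n → ℝ := fun k i => s k * X i (f k)
  have hmul (k : Fin m) (y : Fin n → ℝ) : ∑ i, a k i * y i = s k * ∑ i, X i (f k) * y i := by
    simp only [a, Finset.mul_sum, mul_assoc]
  obtain ⟨hind, hmap⟩ := iIndepFun_and_map_orthonormal_forms hY hlaw (a := a)
    (fun k => by
      simp only [a, mul_pow]
      rw [← Finset.mul_sum, hnorm, ← sq_abs, hs]; norm_num)
    (fun k l hkl => by
      rw [hmul, Finset.sum_congr rfl fun i _ => (mul_left_comm (X i (f k)) (s l) (X i (f l))),
        ← Finset.mul_sum, horth _ _ (hf.ne hkl), mul_zero, mul_zero])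
  have hmeas (k : Fin m) : Measurable fun ω => ∑ i, a k i * Y ω i := by fun_prop
  have hhalf (k : Fin m) :
      P ((fun ω => ∑ i, a k i * Y ω i) ⁻¹' Set.Ioi (∑ i, a k i * μ i)) = 1 / 2 := by
    rw [← Measure.map_apply (hmeas k) measurableSet_Ioi, hmap, gaussianReal_Ioi_mean _ hv]
  refine (measure_mono fun ω hω => ?_).trans (measure_card_mem_le hind
    (s := fun k => Set.Ioi (∑ i, a k i * μ i)) (fun k => measurableSet_Ioi) hhalf (fun k => ?_) t)
  · have hsel : ∀ k, ∃ l, ∑ i, a k i * μ i < ∑ i, a k i * Y ω i →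
        B l = B (f k) ∧ θhat ω l ≠ 0 := by
      intro k
      by_cases hk : ∑ i, a k i * μ i < ∑ i, a k i * Y ω i
      swap
      · exact ⟨f k, fun h => absurd h hk⟩
      suffices h : ∃ l, B l = B (f k) ∧ θhat ω l ≠ 0 from h.imp fun _ h _ => h
      by_contra! h
      have hle := abs_corr_le_of_block_eq_zero X B horth (Y ω) lam (θhat ω) (hθhat ω) (f k)
        (hnorm _) h
      rw [hmul, hmul, hsabs] at hk
      have := le_abs_self (s k * ∑ i, X i (f k) * Y ω i)
      rw [abs_mul, hs, one_mul] at this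
      linarith [hsignal k]
    choose g hg using hsel
    refine le_trans ?_ (show _ ≤ t from hω)
    refine Nat.cast_le.mpr (Finset.card_le_card_of_injOn g (fun k hk => ?_) fun k hk l hl hkl => ?_)
    · simp only [Finset.coe_filter, Finset.mem_univ, true_and, Set.mem_ofPred_eq,
        Set.mem_Ioi] at hk ⊢
      exact (hg k hk).2
    · simp only [Finset.coe_filter, Finset.mem_univ, true_and, Set.mem_ofPred_eq,
        Set.mem_Ioi] at hk hl
      exact hf (by rw [Function.comp_apply, Function.comp_apply, ← (hg k hk).1, ← (hg l hl).1, hkl])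
  · rw [Set.preimage_compl, prob_compl_eq_one_sub (hmeas k measurableSet_Ioi), hhalf]
    simp

/-- In the Gaussian linear model with block-orthogonal unit-norm columns, if at least `Kξ`
blocks contain a variable `j` with `|X_jᵀμ| ≥ λ` (where `μ = Xθ`), then the number of Lasso
selections `R` is stochastically larger than `Binomial(⌈Kξ⌉, 1/2)` and, for `0 ≤ q < ξ/2`,
`P(R ≤ Kq) ≤ exp(−K(ξ−2q)²/(4ξ))`. -/
theorem lasso_selection_lower_bound {Ω : Type*} [MeasurableSpace Ω] (P : Measure Ω)
    [IsProbabilityMeasure P] {n d K : ℕ}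
    (X : Matrix (Fin n) (Fin d) ℝ) (B : Fin d → Fin K)
    (horth : ∀ j l : Fin d, B j ≠ B l → ∑ i, X i j * X i l = 0)
    (hnorm : ∀ j : Fin d, ∑ i, (X i j) ^ 2 = 1)
    (θtrue : Fin d → ℝ) (σ : ℝ) (hσ : 0 < σ)
    (Y : Ω → Fin n → ℝ) (hY_meas : Measurable Y)
    (hY_law : Measure.map Y P =
      Measure.pi (fun i : Fin n => gaussianReal (X.mulVec θtrue i) ⟨σ ^ 2, sq_nonneg σ⟩))
    (lam : ℝ) (hlam : 0 < lam) (ξ : ℝ) (hξ0 : 0 < ξ) (hξ1 : ξ ≤ 1)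
    (hsignal : (K : ℝ) * ξ ≤
      ((Finset.univ.filter (fun k : Fin K =>
        ∃ j, B j = k ∧ lam ≤ |∑ i, X i j * X.mulVec θtrue i|)).card : ℝ))
    (θhat : Ω → Fin d → ℝ)
    (hθhat : ∀ ω, ∀ η : Fin d → ℝ,
      lassoObj X (Y ω) lam (θhat ω) ≤ lassoObj X (Y ω) lam η) :
    (∀ t : ℝ,
      P {ω | ((Finset.univ.filter (fun j : Fin d => θhat ω j ≠ 0)).card : ℝ) ≤ t} ≤
        (PMF.binomial (1 / 2) (by norm_num) ⌈(K : ℝ) * ξ⌉₊).toMeasure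
          {x | ((x : ℕ) : ℝ) ≤ t}) ∧
    (∀ q : ℝ, 0 ≤ q → q < ξ / 2 →
      P {ω | ((Finset.univ.filter (fun j : Fin d => θhat ω j ≠ 0)).card : ℝ) ≤ K * q} ≤
        ENNReal.ofReal (Real.exp (-(K * (ξ - 2 * q) ^ 2) / (4 * ξ)))) := by
  have hcard : ⌈(K : ℝ) * ξ⌉₊ ≤ (Finset.univ.filter (fun k : Fin K =>
      ∃ j, B j = k ∧ lam ≤ |∑ i, X i j * X.mulVec θtrue i|)).card := Nat.ceil_le.mpr hsignal
  obtain ⟨f, hf, hfsig⟩ : ∃ f : Fin ⌈(K : ℝ) * ξ⌉₊ → Fin d, Function.Injective (B ∘ f) ∧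
      ∀ k, lam ≤ |∑ i, X i (f k) * X.mulVec θtrue i| := by
    obtain ⟨e⟩ := Function.Embedding.nonempty_of_card_le
      (α := Fin ⌈(K : ℝ) * ξ⌉₊)
      (β := (Finset.univ.filter (fun k : Fin K =>
        ∃ j, B j = k ∧ lam ≤ |∑ i, X i j * X.mulVec θtrue i|)))
      (by rwa [Fintype.card_fin, Fintype.card_coe])
    choose f hfB hfsig using fun k => (Finset.mem_filter.mp (e k).2).2
    refine ⟨f, fun k l hkl => e.injective (Subtype.ext ?_), hfsig⟩
    rw [← hfB k, ← hfB l]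
    exact hkl
  have hdom := measure_card_selected_le P X B horth hnorm _
    (v := ⟨σ ^ 2, sq_nonneg σ⟩) (fun h => (pow_pos hσ 2).ne' (congrArg NNReal.toReal h))
    Y hY_meas hY_law lam f hf hfsig θhat hθhat
  refine ⟨fun t => (hdom t).trans (binomial_half_toMeasure_le _ _ _).ge, fun q hq0 hq => ?_⟩
  rcases Nat.eq_zero_or_pos K with hK | hK
  · refine prob_le_one.trans ?_
    simp [hK]
  · refine (hdom _).trans (ENNReal.ofReal_le_ofReal ?_)
    have hK' : (0 : ℝ) < K := by exact_mod_cast hK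
    have hc : (0 : ℝ) < K * ξ := by positivity
    have hceil : (K : ℝ) * ξ ≤ ⌈(K : ℝ) * ξ⌉₊ := Nat.le_ceil _
    have hm : 0 < ⌈(K : ℝ) * ξ⌉₊ := Nat.ceil_pos.mpr hc
    generalize ⌈(K : ℝ) * ξ⌉₊ = m at hceil hm
    have hm' : (0 : ℝ) < m := by exact_mod_cast hm
    have hqc : 2 * (K * q) ≤ K * ξ := by nlinarith
    refine (fairBinomialCDF_le_exp hm (by linarith)).trans (Real.exp_le_exp.mpr ?_)
    have hrate : (K * (ξ - 2 * q) ^ 2) / ξ ≤ (m - 2 * (K * q)) ^ 2 / m := by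
      have : (K * (ξ - 2 * q) ^ 2) / ξ = (K * ξ - 2 * (K * q)) ^ 2 / (K * ξ) := by
        field_simp
      rw [this, div_le_div_iff₀ hc hm']
      have hb0 : 0 ≤ 2 * (K * q) := by positivity
      have hbc : (2 * (K * q)) ^ 2 ≤ m * (K * ξ) := by
        nlinarith [mul_le_mul hqc hqc hb0 hc.le, mul_le_mul_of_nonneg_right hceil hc.le]
      nlinarith [mul_nonneg (sub_nonneg.mpr hceil) (sub_nonneg.mpr hbc)]
    have hrate0 : 0 ≤ (K * (ξ - 2 * q) ^ 2) / ξ := by positivity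
    rw [neg_div, neg_div, neg_le_neg_iff]
    calc (K * (ξ - 2 * q) ^ 2) / (4 * ξ) = ((K * (ξ - 2 * q) ^ 2) / ξ) / 4 := by
          rw [div_div, mul_comm ξ 4]
      _ ≤ ((m - 2 * (K * q)) ^ 2 / m) / 2 := by linarith
      _ = (m - 2 * (K * q)) ^ 2 / (2 * m) := by rw [div_div, mul_comm (m : ℝ) 2]
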